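/- arXiv:2007.00275 — 5 statements merged into one kernel-verified Lean document; each statement's English description precedes it below -/
import Mathlib

section
/- Let V ⊆ W₁ ⊕ W₂ be a Lagrangian subspace with respect to the form Ω = Ω₁ ⊖ Ω₂. Then dim(V ∩ W₁) = dim(V ∩ W₂). -/
open Module

theorem Submodule.finrank_comap_inr_add_finrank_map_fst {K M N : Type*} [Field K]
    [AddCommGroup M] [Module K M] [AddCommGroup N] [Module K N]
    [FiniteDimensional K M] [FiniteDimensional K N] (V : Submodule K (M × N)) :
    finrank K (V.comap (LinearMap.inr K M N)) + finrank K (V.map (LinearMap.fst K M N)) =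
      finrank K V := by
  have h := ((LinearMap.fst K M N).domRestrict V).finrank_range_add_finrank_ker
  have e : V.comap (LinearMap.inr K M N) ≃ₗ[K] ((LinearMap.fst K M N).domRestrict V).ker :=
    { toFun := fun x => ⟨⟨(0, x.1), x.2⟩, rfl⟩
      map_add' := fun x y => by ext <;> simp
      map_smul' := fun c x => by ext <;> simp
      invFun := fun x => ⟨x.1.1.2, by
        obtain ⟨⟨⟨a, b⟩, hV⟩, ha⟩ := x
        obtain rfl : a = 0 := ha
        exact hV⟩
      left_inv := fun _ => rfl
      right_inv := by
        rintro ⟨⟨⟨a, b⟩, hV⟩, ha⟩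
        obtain rfl : a = 0 := ha
        rfl }
  rw [LinearMap.range_domRestrict, ← e.finrank_eq] at h
  omega

theorem Submodule.finrank_comap_inl_add_finrank_map_snd {K M N : Type*} [Field K]
    [AddCommGroup M] [Module K M] [AddCommGroup N] [Module K N]
    [FiniteDimensional K M] [FiniteDimensional K N] (V : Submodule K (M × N)) :
    finrank K (V.comap (LinearMap.inl K M N)) + finrank K (V.map (LinearMap.snd K M N)) =
      finrank K V := by
  have h := (V.map (LinearEquiv.prodComm K M N).toLinearMap).finrank_comap_inr_add_finrank_map_fst
  rwa [LinearEquiv.finrank_map_eq, ← Submodule.map_comp, Submodule.map_equiv_eq_comap_symm,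
    ← Submodule.comap_comp] at h

theorem LinearMap.IsAlt.finrank_add_finrank_orthogonal {K M : Type*} [Field K]
    [AddCommGroup M] [Module K M] [FiniteDimensional K M] {B : M →ₗ[K] M →ₗ[K] K}
    (hB : B.IsAlt) (hnd : ∀ u, (∀ v, B u v = 0) → u = 0) (S : Submodule K M) :
    finrank K S + finrank K (S.orthogonalBilin B) = finrank K M := by
  have hB' : B.Nondegenerate := hB.isRefl.nondegenerate_iff_separatingLeft.mpr hnd
  have h := LinearMap.BilinForm.finrank_orthogonal hB' S
  have := S.finrank_le
  change finrank K (S.orthogonalBilin B) = _ at h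
  omega

/-- Let `V ⊆ W₁ ⊕ W₂` be a Lagrangian subspace with respect to the form
`Ω = Ω₁ ⊖ Ω₂`. Then `dim (V ∩ W₁) = dim (V ∩ W₂)`. -/
theorem lagrangian_inter_finrank_eq
    (n : ℕ) (hn : 1 ≤ n)
    (W₁ W₂ : Type) [AddCommGroup W₁] [Module ℂ W₁] [AddCommGroup W₂] [Module ℂ W₂]
    [FiniteDimensional ℂ W₁] [FiniteDimensional ℂ W₂]
    (hdim₁ : finrank ℂ W₁ = 2 * n) (hdim₂ : finrank ℂ W₂ = 2 * n)
    (Ω₁ : W₁ →ₗ[ℂ] W₁ →ₗ[ℂ] ℂ) (Ω₂ : W₂ →ₗ[ℂ] W₂ →ₗ[ℂ] ℂ)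
    (halt₁ : ∀ u, Ω₁ u u = 0) (halt₂ : ∀ u, Ω₂ u u = 0)
    (hnd₁ : ∀ u, (∀ v, Ω₁ u v = 0) → u = 0)
    (hnd₂ : ∀ u, (∀ v, Ω₂ u v = 0) → u = 0)
    (V : Submodule ℂ (W₁ × W₂))
    (hV : ∀ w : W₁ × W₂, w ∈ V ↔ ∀ v ∈ V, Ω₁ w.1 v.1 - Ω₂ w.2 v.2 = 0) :
    finrank ℂ (V.comap (LinearMap.inl ℂ W₁ W₂)) =
      finrank ℂ (V.comap (LinearMap.inr ℂ W₁ W₂)) := by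
  have e₁ : V.comap (LinearMap.inl ℂ W₁ W₂) =
      (V.map (LinearMap.fst ℂ W₁ W₂)).orthogonalBilin Ω₁ := by
    ext u
    rw [Submodule.mem_comap, hV]
    simp only [Submodule.mem_orthogonalBilin_iff, LinearMap.inl_apply,
      map_zero, LinearMap.zero_apply, sub_zero]
    simp only [Submodule.mem_map, forall_exists_index, and_imp, forall_apply_eq_imp_iff₂,
      LinearMap.fst_apply]
    exact forall₂_congr fun v _ => LinearMap.IsAlt.eq_iff halt₁
  have e₂ : V.comap (LinearMap.inr ℂ W₁ W₂) =
      (V.map (LinearMap.snd ℂ W₁ W₂)).orthogonalBilin Ω₂ := by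
    ext u
    rw [Submodule.mem_comap, hV]
    simp only [Submodule.mem_orthogonalBilin_iff, LinearMap.inr_apply,
      map_zero, LinearMap.zero_apply, zero_sub, neg_eq_zero]
    simp only [Submodule.mem_map, forall_exists_index, and_imp, forall_apply_eq_imp_iff₂,
      LinearMap.snd_apply]
    exact forall₂_congr fun v _ => LinearMap.IsAlt.eq_iff halt₂
  have h₁ := LinearMap.IsAlt.finrank_add_finrank_orthogonal halt₁ hnd₁
    (V.map (LinearMap.fst ℂ W₁ W₂))
  have h₂ := LinearMap.IsAlt.finrank_add_finrank_orthogonal halt₂ hnd₂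
    (V.map (LinearMap.snd ℂ W₁ W₂))
  rw [← e₁] at h₁
  rw [← e₂] at h₂
  have h₃ := V.finrank_comap_inr_add_finrank_map_fst
  have h₄ := V.finrank_comap_inl_add_finrank_map_snd
  omega
end

section
/- Let V ⊆ W₁ ⊕ W₂ be a Lagrangian subspace with respect to Ω = Ω₁ ⊖ Ω₂, and let p_i : W₁ ⊕ W₂ → W_i denote the canonical projections. Then for i = 1, 2 the image p_i(V) equals the Ω_i-orthogonal complement of V ∩ W_i inside W_i; equivalently, V ∩ W_i = {w ∈ W_i : Ω_i(w, p_i(v)) = 0 for all v ∈ V}. -/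
open Module

/-- A subspace is its own double orthogonal complement with respect to a nondegenerate alternating
form on a finite-dimensional space. -/
theorem mem_iff_forall_of_alternating_of_nondegenerate {K M : Type*} [Field K] [AddCommGroup M]
    [Module K M] [FiniteDimensional K M] (B : LinearMap.BilinForm K M) (halt : ∀ u, B u u = 0)
    (hnd : ∀ u, (∀ v, B u v = 0) → u = 0) (P : Submodule K M) (w : M) :
    w ∈ P ↔ ∀ v, (∀ u ∈ P, B v u = 0) → B w v = 0 := by
  have hB : B.IsAlt := halt
  have hrefl : B.IsRefl := hB.isRefl
  have hnon : B.Nondegenerate := hrefl.nondegenerate_iff_separatingLeft.mpr hnd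
  nth_rw 1 [← B.orthogonal_orthogonal hnon hrefl P]
  simp only [LinearMap.BilinForm.mem_orthogonal_iff]
  exact forall_congr' fun v => imp_congr
    (forall₂_congr fun u _ => hrefl.eq_iff) hrefl.eq_iff

/-- For a Lagrangian subspace `V ⊆ W₁ ⊕ W₂` (w.r.t. `Ω = Ω₁ ⊖ Ω₂`) and the
canonical projections `p_i`, the image `p_i(V)` equals the `Ω_i`-orthogonal complement of
`V ∩ W_i` inside `W_i`; equivalently `V ∩ W_i = {w ∈ W_i : Ω_i(w, p_i(v)) = 0 for all v ∈ V}`. -/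
theorem lagrangian_proj_eq_orthogonal
    (n : ℕ) (hn : 1 ≤ n)
    (W₁ W₂ : Type) [AddCommGroup W₁] [Module ℂ W₁] [AddCommGroup W₂] [Module ℂ W₂]
    [FiniteDimensional ℂ W₁] [FiniteDimensional ℂ W₂]
    (hdim₁ : finrank ℂ W₁ = 2 * n) (hdim₂ : finrank ℂ W₂ = 2 * n)
    (Ω₁ : W₁ →ₗ[ℂ] W₁ →ₗ[ℂ] ℂ) (Ω₂ : W₂ →ₗ[ℂ] W₂ →ₗ[ℂ] ℂ)
    (halt₁ : ∀ u, Ω₁ u u = 0) (halt₂ : ∀ u, Ω₂ u u = 0)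
    (hnd₁ : ∀ u, (∀ v, Ω₁ u v = 0) → u = 0)
    (hnd₂ : ∀ u, (∀ v, Ω₂ u v = 0) → u = 0)
    (V : Submodule ℂ (W₁ × W₂))
    (hV : ∀ w : W₁ × W₂, w ∈ V ↔ ∀ v ∈ V, Ω₁ w.1 v.1 - Ω₂ w.2 v.2 = 0) :
    ((V.map (LinearMap.fst ℂ W₁ W₂) : Set W₁) =
        {w : W₁ | ∀ v : W₁, (v, (0 : W₂)) ∈ V → Ω₁ w v = 0}) ∧
    ((V.map (LinearMap.snd ℂ W₁ W₂) : Set W₂) =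
        {w : W₂ | ∀ v : W₂, ((0 : W₁), v) ∈ V → Ω₂ w v = 0}) ∧
    (∀ w : W₁, (w, (0 : W₂)) ∈ V ↔ ∀ v ∈ V, Ω₁ w v.1 = 0) ∧
    (∀ w : W₂, ((0 : W₁), w) ∈ V ↔ ∀ v ∈ V, Ω₂ w v.2 = 0) := by
  have inl_mem : ∀ w : W₁, (w, (0 : W₂)) ∈ V ↔ ∀ v ∈ V, Ω₁ w v.1 = 0 := fun w => by
    simpa using hV (w, 0)
  have inr_mem : ∀ w : W₂, ((0 : W₁), w) ∈ V ↔ ∀ v ∈ V, Ω₂ w v.2 = 0 := fun w => by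
    simpa using hV (0, w)
  refine ⟨?_, ?_, inl_mem, inr_mem⟩
  · ext w
    rw [SetLike.mem_coe, mem_iff_forall_of_alternating_of_nondegenerate Ω₁ halt₁ hnd₁]
    simp only [Submodule.mem_map, forall_exists_index, and_imp, forall_apply_eq_imp_iff₂,
      LinearMap.fst_apply, Set.mem_ofPred_eq, inl_mem]
  · ext w
    rw [SetLike.mem_coe, mem_iff_forall_of_alternating_of_nondegenerate Ω₂ halt₂ hnd₂]
    simp only [Submodule.mem_map, forall_exists_index, and_imp, forall_apply_eq_imp_iff₂,
      LinearMap.snd_apply, Set.mem_ofPred_eq, inr_mem]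
end

section
/- Let V and V′ be Lagrangian subspaces of W₁ ⊕ W₂ with respect to Ω = Ω₁ ⊖ Ω₂ such that dim(V ∩ W₁) = dim(V′ ∩ W₁). Then there exist linear automorphisms g of W₁ with Ω₁(g(u), g(v)) = Ω₁(u,v) for all u,v ∈ W₁, and h of W₂ with Ω₂(h(u), h(v)) = Ω₂(u,v) for all u,v ∈ W₂, such that (g ⊕ h)(V) = V′. (That is, the locus LG(k) of Lagrangians V with dim(V ∩ W₁) = dim(V ∩ W₂) = k is a single Sp(W₁) × Sp(W₂)-orbit.) -/
open Module

section Auxiliary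

variable {K : Type*} [Field K]

/-- The value of a map extended from `U` to `U ⊔ span {w}` may be prescribed at `w ∉ U`. -/
theorem LinearMap.exists_eqOn_apply_eq {W W' : Type*} [AddCommGroup W] [Module K W]
    [AddCommGroup W'] [Module K W'] {U : Submodule K W} {w : W} (hw : w ∉ U)
    (F : W →ₗ[K] W') (w' : W') :
    ∃ G : W →ₗ[K] W', (∀ u ∈ U, G u = F u) ∧ G w = w' := by
  obtain ⟨l, hlw, hlU⟩ := Submodule.exists_le_ker_of_notMem hw
  refine ⟨F + l.smulRight ((l w)⁻¹ • (w' - F w)), fun u hu => ?_, ?_⟩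
  · have : l u = 0 := hlU hu
    simp [this]
  · simp [smul_smul, mul_inv_cancel₀ hlw]

/-- Two linear maps with the same range and with domains of the same finite dimension differ by an
isomorphism of their domains. -/
theorem LinearMap.exists_linearEquiv_apply_eq_of_range_eq {A A' Q : Type*}
    [AddCommGroup A] [Module K A] [FiniteDimensional K A]
    [AddCommGroup A'] [Module K A'] [FiniteDimensional K A'] [AddCommGroup Q] [Module K Q]
    (p : A →ₗ[K] Q) (p' : A' →ₗ[K] Q) (hrange : p.range = p'.range)
    (hdim : finrank K A = finrank K A') :
    ∃ e : A ≃ₗ[K] A', ∀ x, p' (e x) = p x := by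
  obtain ⟨C, hC⟩ := p.ker.exists_isCompl
  obtain ⟨C', hC'⟩ := p'.ker.exists_isCompl
  have hker : finrank K p.ker = finrank K p'.ker := by
    have h := p.finrank_range_add_finrank_ker
    have h' := p'.finrank_range_add_finrank_ker
    rw [hrange] at h
    omega
  let a := p.rangeRestrict.equivProdOfSurjectiveOfIsCompl (p.ker.projectionOnto C hC)
    p.range_rangeRestrict (Submodule.range_projectionOnto hC)
    (by simpa [LinearMap.ker_rangeRestrict] using hC)
  let a' := p'.rangeRestrict.equivProdOfSurjectiveOfIsCompl (p'.ker.projectionOnto C' hC')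
    p'.range_rangeRestrict (Submodule.range_projectionOnto hC')
    (by simpa [LinearMap.ker_rangeRestrict] using hC')
  let m := (LinearEquiv.ofEq _ _ hrange).prodCongr (LinearEquiv.ofFinrankEq _ _ hker)
  refine ⟨(a.trans m).trans a'.symm, fun x => ?_⟩
  have h : (a' (a'.symm (m (a x)))).1 = (m (a x)).1 := by rw [a'.apply_symm_apply]
  exact congrArg Subtype.val h

/-- A linear relation has a linear section over its projection to the second factor. -/
theorem Submodule.exists_linearMap_prod_mem {W W' : Type*} [AddCommGroup W] [Module K W]
    [AddCommGroup W'] [Module K W'] (V : Submodule K (W × W')) :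
    ∃ s : V.map (LinearMap.snd K W W') →ₗ[K] W, ∀ b, (s b, (b : W')) ∈ V := by
  have hsurj : ((LinearMap.snd K W W').submoduleMap V).range = ⊤ :=
    LinearMap.range_eq_top.2 (LinearMap.submoduleMap_surjective _ _)
  obtain ⟨t, ht⟩ := LinearMap.exists_rightInverse_of_surjective _ hsurj
  refine ⟨LinearMap.fst K W W' ∘ₗ V.subtype ∘ₗ t, fun b => ?_⟩
  have hb : ((t b : V) : W × W').2 = b := congrArg Subtype.val (LinearMap.congr_fun ht b)
  rw [← hb]
  exact (t b).2

/-- If `V` is Lagrangian for `B ⊖ B'`, then `V ∩ W` is the orthogonal of the projection of `V`. -/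
theorem orthogonal_map_fst_of_lagrangian {W W' : Type*} [AddCommGroup W] [Module K W]
    [AddCommGroup W'] [Module K W'] {B : LinearMap.BilinForm K W} {B' : LinearMap.BilinForm K W'}
    {V : Submodule K (W × W')} (hB : B.IsAlt)
    (hV : ∀ w : W × W', w ∈ V ↔ ∀ v ∈ V, B w.1 v.1 - B' w.2 v.2 = 0) :
    B.orthogonal (V.map (LinearMap.fst K W W')) = V.comap (LinearMap.inl K W W') := by
  ext a
  rw [Submodule.mem_comap, hV]
  constructor
  · intro ha v hv
    simpa using hB.isRefl _ _ (ha v.1 ⟨v, hv, rfl⟩)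
  · rintro ha _ ⟨v, hv, rfl⟩
    exact hB.isRefl _ _ (by simpa using ha v hv)

/-- If `V` is Lagrangian for `B ⊖ B'`, then the projection of `V` is the orthogonal of `V ∩ W`. -/
theorem mem_map_fst_iff_of_lagrangian {W W' : Type*} [AddCommGroup W] [Module K W]
    [FiniteDimensional K W] [AddCommGroup W'] [Module K W']
    {B : LinearMap.BilinForm K W} {B' : LinearMap.BilinForm K W'}
    {V : Submodule K (W × W')} (hB : B.IsAlt) (hnd : B.Nondegenerate)
    (hV : ∀ w : W × W', w ∈ V ↔ ∀ v ∈ V, B w.1 v.1 - B' w.2 v.2 = 0) (a : W) :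
    a ∈ V.map (LinearMap.fst K W W') ↔ ∀ k ∈ V.comap (LinearMap.inl K W W'), B k a = 0 := by
  rw [← LinearMap.BilinForm.orthogonal_orthogonal hnd hB.isRefl (V.map _),
    orthogonal_map_fst_of_lagrangian hB hV]
  rfl

variable {W W' : Type*} [AddCommGroup W] [Module K W] [FiniteDimensional K W]
  [AddCommGroup W'] [Module K W'] [FiniteDimensional K W']
  {B' : LinearMap.BilinForm K W'} {B : LinearMap.BilinForm K W}

/-- The one-dimensional extension step in Witt's theorem for alternating forms. -/
theorem LinearMap.BilinForm.exists_notMem_map_apply_eq (hB : B.IsAlt) (hB' : B'.IsAlt)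
    (hnd : B.Nondegenerate) (hnd' : B'.Nondegenerate) (hdim : finrank K W = finrank K W')
    {U : Submodule K W} {F : W →ₗ[K] W'} (hinj : ∀ u ∈ U, F u = 0 → u = 0)
    (hF : ∀ u ∈ U, ∀ v ∈ U, B' (F u) (F v) = B u v) {w : W} (hw : w ∉ U) :
    ∃ w' ∉ U.map F, ∀ u ∈ U, B' w' (F u) = B w u := by
  by_contra! hcon
  replace hcon : ∀ w', (∀ u ∈ U, B' w' (F u) = B w u) → w' ∈ U.map F := fun w' h => by
    by_contra hw'
    obtain ⟨u, hu, hne⟩ := hcon w' hw'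
    exact hne (h u hu)
  have hker : LinearMap.ker (F.domRestrict U) = ⊥ :=
    (LinearMap.ker_eq_bot').2 fun u hu => Subtype.ext (hinj u u.2 hu)
  obtain ⟨L, hL⟩ := (F.domRestrict U).exists_leftInverse_of_injective hker
  set w₀ := (B'.toDual hnd').symm ((B w) ∘ₗ U.subtype ∘ₗ L) with hw₀
  have hw₀U : ∀ u ∈ U, B' w₀ (F u) = B w u := fun u hu => by
    have : L (F u) = ⟨u, hu⟩ := LinearMap.congr_fun hL ⟨u, hu⟩
    rw [hw₀, LinearMap.BilinForm.apply_toDual_symm_apply]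
    simp [this]
  obtain ⟨u₀, hu₀, hu₀w⟩ := hcon w₀ hw₀U
  have hle : B'.orthogonal (U.map F) ≤ (U ⊓ B.orthogonal U).map F := by
    intro t ht
    have ht' : ∀ u ∈ U, B' (F u) t = 0 := fun u hu => ht _ ⟨u, hu, rfl⟩
    have hsum : w₀ + t ∈ U.map F := hcon _ fun u hu => by
      rw [map_add, LinearMap.add_apply, hw₀U u hu, hB'.isRefl _ _ (ht' u hu), add_zero]
    obtain ⟨u₁, hu₁, hu₁t⟩ := hsum
    have htF : F (u₁ - u₀) = t := by rw [map_sub, hu₁t, hu₀w]; abel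
    have hmem : u₁ - u₀ ∈ U := U.sub_mem hu₁ hu₀
    refine ⟨u₁ - u₀, ⟨hmem, fun u hu => ?_⟩, htF⟩
    change B u (u₁ - u₀) = 0
    rw [← hF u hu _ hmem, htF, ht' u hu]
  have hmap : finrank K (U.map F) = finrank K U := by
    rw [← LinearMap.range_domRestrict]
    exact LinearMap.finrank_range_of_inj (LinearMap.ker_eq_bot.1 hker)
  have hfin : finrank K (B.orthogonal U) ≤ finrank K (U ⊓ B.orthogonal U : Submodule K W) := by
    have h := (Submodule.finrank_mono hle).trans (Submodule.finrank_map_le F _)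
    rwa [LinearMap.BilinForm.finrank_orthogonal hnd', hmap, ← hdim,
      ← LinearMap.BilinForm.finrank_orthogonal hnd] at h
  have horth : B.orthogonal U ≤ U :=
    (Submodule.eq_of_le_of_finrank_le inf_le_right hfin).symm.le.trans inf_le_left
  have hdiff : w - u₀ ∈ B.orthogonal U := fun u hu => hB.isRefl _ _ <| by
    rw [map_sub, LinearMap.sub_apply, ← hw₀U u hu, ← hu₀w, hF u₀ hu₀ u hu, sub_self]
  exact hw (by simpa using U.add_mem (horth hdiff) hu₀)

/-- **Witt's extension theorem** for alternating forms: an injective isometry defined on a subspace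
of a symplectic space, with values in a symplectic space of the same dimension, extends to an
isometric isomorphism. -/
theorem LinearMap.BilinForm.exists_linearEquiv_extending (hB : B.IsAlt) (hB' : B'.IsAlt)
    (hnd : B.Nondegenerate) (hnd' : B'.Nondegenerate) (hdim : finrank K W = finrank K W')
    (U : Submodule K W) (F : W →ₗ[K] W') (hinj : ∀ u ∈ U, F u = 0 → u = 0)
    (hF : ∀ u ∈ U, ∀ v ∈ U, B' (F u) (F v) = B u v) :
    ∃ g : W ≃ₗ[K] W', (∀ u v, B' (g u) (g v) = B u v) ∧ ∀ u ∈ U, g u = F u := by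
  induction U using WellFoundedGT.induction generalizing F with
  | ind U ih =>
    by_cases hU : U = ⊤
    · subst hU
      have hFinj : Function.Injective F :=
        (injective_iff_map_eq_zero F).2 fun u => hinj u trivial
      exact ⟨F.linearEquivOfInjective hFinj hdim, fun u v => hF u trivial v trivial,
        fun u _ => rfl⟩
    obtain ⟨w, -, hw⟩ := SetLike.exists_of_lt (lt_top_iff_ne_top.2 hU)
    obtain ⟨w', hw', hw'U⟩ :=
      LinearMap.BilinForm.exists_notMem_map_apply_eq hB hB' hnd hnd' hdim hinj hF hw
    obtain ⟨G, hGU, hGw⟩ := LinearMap.exists_eqOn_apply_eq hw F w'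
    have hlt : U < U ⊔ K ∙ w := Submodule.lt_sup_iff_notMem.2 hw
    have hmem : ∀ x ∈ U ⊔ K ∙ w, ∃ u ∈ U, ∃ c : K, x = u + c • w := fun x hx => by
      obtain ⟨u, hu, y, hy, rfl⟩ := Submodule.mem_sup.1 hx
      obtain ⟨c, rfl⟩ := Submodule.mem_span_singleton.1 hy
      exact ⟨u, hu, c, rfl⟩
    have hG : ∀ u ∈ U, ∀ c : K, G (u + c • w) = F u + c • w' := fun u hu c => by
      rw [map_add, map_smul, hGU u hu, hGw]
    obtain ⟨g, hg, hgG⟩ := ih (U ⊔ K ∙ w) hlt G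
      (fun x hx h0 => by
        obtain ⟨u, hu, c, rfl⟩ := hmem x hx
        rw [hG u hu] at h0
        by_cases hc : c = 0
        · subst hc
          simpa using hinj u hu (by simpa using h0)
        · refine absurd ⟨-(c⁻¹ • u), U.neg_mem (U.smul_mem _ hu), ?_⟩ hw'
          rw [map_neg, map_smul, eq_neg_of_add_eq_zero_left h0, smul_neg, neg_neg, smul_smul,
            inv_mul_cancel₀ hc, one_smul])
      (fun x hx y hy => by
        obtain ⟨u, hu, c, rfl⟩ := hmem x hx
        obtain ⟨v, hv, d, rfl⟩ := hmem y hy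
        have huw : B' (F u) w' = B u w := by
          rw [← hB'.neg_eq, ← hB.neg_eq, hw'U u hu]
        simp [hG u hu, hG v hv, hF u hu v hv, hw'U v hv, huw, hB.self_eq_zero,
          hB'.self_eq_zero])
    exact ⟨g, hg, fun u hu => (hgG u (hlt.le hu)).trans (hGU u hu)⟩

/-- A subspace that is Lagrangian for `B ⊖ B'` has half the dimension of `W × W'`. -/
theorem two_mul_finrank_of_lagrangian {V : Submodule K (W × W')} (hB : B.IsAlt) (hB' : B'.IsAlt)
    (hnd : B.Nondegenerate) (hnd' : B'.Nondegenerate)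
    (hV : ∀ w : W × W', w ∈ V ↔ ∀ v ∈ V, B w.1 v.1 - B' w.2 v.2 = 0) :
    2 * finrank K V = finrank K W + finrank K W' := by
  let Ω : LinearMap.BilinForm K (W × W') :=
    B.compl₁₂ (LinearMap.fst K W W') (LinearMap.fst K W W') -
      B'.compl₁₂ (LinearMap.snd K W W') (LinearMap.snd K W W')
  have hΩ : ∀ x y, Ω x y = B x.1 y.1 - B' x.2 y.2 := fun x y => by simp [Ω]
  have halt : Ω.IsAlt := fun x => by rw [hΩ, hB.self_eq_zero, hB'.self_eq_zero, sub_zero]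
  have hΩnd : Ω.Nondegenerate := by
    refine halt.isRefl.nondegenerate_iff_separatingLeft.2 fun x hx => Prod.ext ?_ ?_
    · exact hnd.1 _ fun y => by simpa [hΩ] using hx (y, 0)
    · exact hnd'.1 _ fun y => by simpa [hΩ] using hx (0, y)
  have horth : Ω.orthogonal V = V := by
    ext w
    rw [hV]
    refine forall₂_congr fun v _ => ?_
    rw [← hΩ]
    exact halt.isRefl.eq_iff
  have h := LinearMap.BilinForm.finrank_orthogonal hΩnd V
  have hle := V.finrank_le
  rw [horth] at h
  rw [finrank_prod] at h hle
  omega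

/-- Rank-nullity for the projection of a subspace of `W × W'` to `W'`. -/
theorem finrank_map_snd_add_finrank_comap_inl (V : Submodule K (W × W')) :
    finrank K (V.map (LinearMap.snd K W W')) + finrank K (V.comap (LinearMap.inl K W W')) =
      finrank K V := by
  rw [← ((LinearMap.snd K W W').domRestrict V).finrank_range_add_finrank_ker,
    LinearMap.range_domRestrict, LinearMap.ker_domRestrict,
    ← Submodule.finrank_map_subtype_eq V, Submodule.map_comap_subtype, LinearMap.ker_snd,
    inf_comm, ← Submodule.map_comap_eq,
    (Submodule.equivMapOfInjective _ (LinearMap.inl_injective (R := K) (M := W) (M₂ := W')) _).finrank_eq]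

end Auxiliary

/-- Two Lagrangian subspaces `V, V′` of `W₁ ⊕ W₂` (w.r.t. `Ω = Ω₁ ⊖ Ω₂`)
with `dim (V ∩ W₁) = dim (V′ ∩ W₁)` lie in the same `Sp(W₁) × Sp(W₂)`-orbit: there exist
symplectic automorphisms `g` of `(W₁, Ω₁)` and `h` of `(W₂, Ω₂)` with `(g ⊕ h)(V) = V′`. -/
theorem lagrangian_orbit_transitive
    (n : ℕ) (hn : 1 ≤ n)
    (W₁ W₂ : Type) [AddCommGroup W₁] [Module ℂ W₁] [AddCommGroup W₂] [Module ℂ W₂]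
    [FiniteDimensional ℂ W₁] [FiniteDimensional ℂ W₂]
    (hdim₁ : finrank ℂ W₁ = 2 * n) (hdim₂ : finrank ℂ W₂ = 2 * n)
    (Ω₁ : W₁ →ₗ[ℂ] W₁ →ₗ[ℂ] ℂ) (Ω₂ : W₂ →ₗ[ℂ] W₂ →ₗ[ℂ] ℂ)
    (halt₁ : ∀ u, Ω₁ u u = 0) (halt₂ : ∀ u, Ω₂ u u = 0)
    (hnd₁ : ∀ u, (∀ v, Ω₁ u v = 0) → u = 0)
    (hnd₂ : ∀ u, (∀ v, Ω₂ u v = 0) → u = 0)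
    (V V' : Submodule ℂ (W₁ × W₂))
    (hV : ∀ w : W₁ × W₂, w ∈ V ↔ ∀ v ∈ V, Ω₁ w.1 v.1 - Ω₂ w.2 v.2 = 0)
    (hV' : ∀ w : W₁ × W₂, w ∈ V' ↔ ∀ v ∈ V', Ω₁ w.1 v.1 - Ω₂ w.2 v.2 = 0)
    (hdim : finrank ℂ (V.comap (LinearMap.inl ℂ W₁ W₂)) =
      finrank ℂ (V'.comap (LinearMap.inl ℂ W₁ W₂))) :
    ∃ (g : W₁ ≃ₗ[ℂ] W₁) (h : W₂ ≃ₗ[ℂ] W₂),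
      (∀ u v : W₁, Ω₁ (g u) (g v) = Ω₁ u v) ∧
      (∀ u v : W₂, Ω₂ (h u) (h v) = Ω₂ u v) ∧
      V.map (LinearMap.prodMap (g : W₁ →ₗ[ℂ] W₁) (h : W₂ →ₗ[ℂ] W₂)) = V' := by
  have hB₁ : LinearMap.BilinForm.IsAlt Ω₁ := halt₁
  have hB₂ : LinearMap.BilinForm.IsAlt Ω₂ := halt₂
  have hN₁ : LinearMap.BilinForm.Nondegenerate Ω₁ :=
    hB₁.isRefl.nondegenerate_iff_separatingLeft.2 hnd₁
  have hN₂ : LinearMap.BilinForm.Nondegenerate Ω₂ :=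
    hB₂.isRefl.nondegenerate_iff_separatingLeft.2 hnd₂
  have hfin : finrank ℂ (V.map (LinearMap.snd ℂ W₁ W₂)) =
      finrank ℂ (V'.map (LinearMap.snd ℂ W₁ W₂)) := by
    have h := finrank_map_snd_add_finrank_comap_inl V
    have h' := finrank_map_snd_add_finrank_comap_inl V'
    have hd := two_mul_finrank_of_lagrangian hB₁ hB₂ hN₁ hN₂ hV
    have hd' := two_mul_finrank_of_lagrangian hB₁ hB₂ hN₁ hN₂ hV'
    omega
  set K₁ := V.comap (LinearMap.inl ℂ W₁ W₂) with hK₁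
  set K₁' := V'.comap (LinearMap.inl ℂ W₁ W₂) with hK₁'
  have hP : ∀ a, a ∈ V.map (LinearMap.fst ℂ W₁ W₂) ↔ ∀ k ∈ K₁, Ω₁ k a = 0 :=
    mem_map_fst_iff_of_lagrangian hB₁ hN₁ hV
  have hP' : ∀ a, a ∈ V'.map (LinearMap.fst ℂ W₁ W₂) ↔ ∀ k ∈ K₁', Ω₁ k a = 0 :=
    mem_map_fst_iff_of_lagrangian hB₁ hN₁ hV'
  let e₀ := LinearEquiv.ofFinrankEq K₁ K₁' hdim
  obtain ⟨F, hF⟩ := (K₁'.subtype ∘ₗ e₀.toLinearMap).exists_extend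
  -- `e₀` extends to an isometry `g` of `W₁`, which carries `K₁` onto its counterpart for `V'`
  have hFe : ∀ k (hk : k ∈ K₁), F k = e₀ ⟨k, hk⟩ := fun k hk => LinearMap.congr_fun hF ⟨k, hk⟩
  have hiso : ∀ k ∈ K₁, ∀ l ∈ K₁, Ω₁ k l = 0 := fun k hk l hl => by
    simpa using (hV (k, 0)).1 hk (l, 0) hl
  have hiso' : ∀ k ∈ K₁', ∀ l ∈ K₁', Ω₁ k l = 0 := fun k hk l hl => by
    simpa using (hV' (k, 0)).1 hk (l, 0) hl
  obtain ⟨g, hg, hgF⟩ := LinearMap.BilinForm.exists_linearEquiv_extending hB₁ hB₁ hN₁ hN₁ rfl K₁ F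
    (fun k hk h0 => by
      rw [hFe k hk] at h0
      simpa using h0)
    (fun k hk l hl => by
      rw [hFe k hk, hFe l hl, hiso k hk l hl]
      exact hiso' _ (e₀ _).2 _ (e₀ _).2)
  have hgK : ∀ k ∈ K₁, g k ∈ K₁' := fun k hk => by
    rw [hgF k hk, hFe k hk]
    exact (e₀ _).2
  have hgK' : ∀ k ∈ K₁', ∃ l ∈ K₁, g l = k := fun k hk => by
    refine ⟨e₀.symm ⟨k, hk⟩, (e₀.symm _).2, ?_⟩
    rw [hgF _ (e₀.symm _).2, hFe _ (e₀.symm _).2]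
    simp
  have hgP : ∀ a, g a ∈ V'.map (LinearMap.fst ℂ W₁ W₂) ↔ a ∈ V.map (LinearMap.fst ℂ W₁ W₂) := by
    intro a
    rw [hP, hP']
    constructor
    · intro h k hk
      rw [← hg]
      exact h _ (hgK k hk)
    · intro h k hk
      obtain ⟨l, hl, rfl⟩ := hgK' k hk
      rw [hg]
      exact h l hl
  -- an isometry between the projections to `W₂`, compatible with `g`
  obtain ⟨s, hs⟩ := V.exists_linearMap_prod_mem
  obtain ⟨s', hs'⟩ := V'.exists_linearMap_prod_mem
  have hsub : ∀ {a a' b}, (a, b) ∈ V → (a', b) ∈ V → a - a' ∈ K₁ := fun h h' => by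
    simpa [hK₁] using V.sub_mem h h'
  have hsub' : ∀ {a a' b}, (a, b) ∈ V' → (a', b) ∈ V' → a - a' ∈ K₁' := fun h h' => by
    simpa [hK₁'] using V'.sub_mem h h'
  have hrange : (K₁'.mkQ ∘ₗ g.toLinearMap ∘ₗ s).range = (K₁'.mkQ ∘ₗ s').range := by
    apply le_antisymm
    · rintro _ ⟨b, rfl⟩
      obtain ⟨⟨a, b'⟩, hab, ha : a = g (s b)⟩ := (hgP (s b)).2 ⟨_, hs b, rfl⟩
      rw [ha] at hab
      exact ⟨⟨b', _, hab, rfl⟩, (Submodule.Quotient.eq _).2 (hsub' (hs' ⟨b', _, hab, rfl⟩) hab)⟩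
    · rintro _ ⟨b', rfl⟩
      obtain ⟨⟨a, b⟩, hab, ha : a = g.symm (s' b')⟩ := (hgP (g.symm (s' b'))).1 (by
        rw [g.apply_symm_apply]
        exact ⟨_, hs' b', rfl⟩)
      rw [ha] at hab
      refine ⟨⟨b, _, hab, rfl⟩, (Submodule.Quotient.eq _).2 ?_⟩
      simpa using hgK _ (hsub (hs ⟨b, _, hab, rfl⟩) hab)
  obtain ⟨e, he⟩ := LinearMap.exists_linearEquiv_apply_eq_of_range_eq _ _ hrange hfin
  have heK : ∀ b, g (s b) - s' (e b) ∈ K₁' := fun b =>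
    (Submodule.Quotient.eq _).1 (he b).symm
  have heV : ∀ b, (g (s b), (e b : W₂)) ∈ V' := fun b => by
    simpa using V'.add_mem (heK b) (hs' (e b))
  obtain ⟨F₂, hF₂⟩ := ((V'.map (LinearMap.snd ℂ W₁ W₂)).subtype ∘ₗ e.toLinearMap).exists_extend
  have hF₂e : ∀ b (hb : b ∈ V.map (LinearMap.snd ℂ W₁ W₂)), F₂ b = e ⟨b, hb⟩ :=
    fun b hb => LinearMap.congr_fun hF₂ ⟨b, hb⟩
  obtain ⟨h, hh, hhF⟩ := LinearMap.BilinForm.exists_linearEquiv_extending hB₂ hB₂ hN₂ hN₂ rfl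
    (V.map (LinearMap.snd ℂ W₁ W₂)) F₂
    (fun b hb h0 => by
      rw [hF₂e b hb] at h0
      simpa using h0)
    (fun b hb c hc => by
      have h₁ := (hV _).1 (hs ⟨b, hb⟩) _ (hs ⟨c, hc⟩)
      have h₂ := (hV' _).1 (heV ⟨b, hb⟩) _ (heV ⟨c, hc⟩)
      rw [hF₂e b hb, hF₂e c hc, ← sub_eq_zero.1 h₂, hg]
      exact sub_eq_zero.1 h₁)
  have hVV' : ∀ v ∈ V, (g v.1, h v.2) ∈ V' := by
    rintro ⟨a, b⟩ hab
    have hb : b ∈ V.map (LinearMap.snd ℂ W₁ W₂) := ⟨_, hab, rfl⟩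
    have hk := hgK _ (hsub hab (hs ⟨b, hb⟩))
    have hhb : h b = e ⟨b, hb⟩ := (hhF b hb).trans (hF₂e b hb)
    simpa [hhb] using V'.add_mem hk (heV ⟨b, hb⟩)
  refine ⟨g, h, hg, hh, le_antisymm ?_ fun w hw => ?_⟩
  · rintro _ ⟨v, hv, rfl⟩
    exact hVV' v hv
  · refine ⟨(g.symm w.1, h.symm w.2), (hV _).2 fun v hv => ?_, by simp⟩
    rw [← hg, ← hh]
    simpa using (hV' w).1 hw _ (hVV' v hv)
end

section
/- Let M be an additively written commutative group equipped with an action of a finite group A by group automorphisms. Suppose M is generated by elements x_{i,j} for 1 ≤ i ≤ m and 1 ≤ j ≤ k_i, such that for each i the set {x_{i,1}, …, x_{i,k_i}} has exactly k_i elements and is a single A-orbit (the A-action permutes these elements transitively). Set x_i := Σ_{j=1}^{k_i} x_{i,j}. Then for every A-invariant element y ∈ M (i.e. a·y = y for all a ∈ A), the element |A|·y lies in the subgroup of M generated by x_1, …, x_m. -/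
/-- Summing the translates of one point of a finite orbit, enumerated without repetition by `x`,
gives the order of its stabilizer times the sum over the orbit. -/
theorem sum_smul_eq_card_smul_sum_orbit {M A ι : Type*} [AddCommGroup M] [Group A] [Fintype A]
    [MulAction A M] [Fintype ι] [DecidableEq M] {x : ι → M} (hinj : Function.Injective x)
    (hstable : ∀ (a : A) (j : ι), ∃ j', a • x j = x j')
    (htrans : ∀ j j' : ι, ∃ a : A, a • x j = x j') (j : ι) :
    ∑ a : A, a • x j = (Finset.univ.filter fun a : A => a • x j = x j).card • ∑ j', x j' := by
  classical
  choose f hf using fun a => hstable a j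
  rw [Finset.smul_sum, ← Finset.sum_fiberwise Finset.univ f]
  refine Finset.sum_congr rfl fun j' _ => ?_
  obtain ⟨b, hb⟩ := htrans j j'
  have hcard : (Finset.univ.filter fun a : A => a • x j = x j).card =
      (Finset.univ.filter fun a : A => f a = j').card := by
    refine Finset.card_equiv (Equiv.mulLeft b) fun a => ?_
    simp only [Finset.mem_filter, Finset.mem_univ, true_and, Equiv.coe_mulLeft]
    rw [← hinj.eq_iff, ← hf, mul_smul, ← hb, smul_left_cancel_iff]
  rw [hcard, ← Finset.sum_const]
  refine Finset.sum_congr rfl fun a ha => ?_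
  rw [hf, (Finset.mem_filter.mp ha).2]


/-- Lemma on finite group actions, cf. Lemma 4.10 of the paper.
Let `M` be a commutative group with an action of a finite group `A` by group
automorphisms. Suppose `M` is generated by elements `x i j` (`i < m`, `j < k i`) such that
for each `i` the set `{x i 0, …, x i (k i - 1)}` has exactly `k i` elements and is a single
`A`-orbit. Set `xᵢ := ∑ j, x i j`. Then for every `A`-invariant `y ∈ M`, the element
`|A| • y` lies in the subgroup generated by the `xᵢ`. -/
theorem card_smul_invariant_mem_orbit_sums
    (M : Type) [AddCommGroup M] (A : Type) [Group A] [Fintype A]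
    [DistribMulAction A M]
    (m : ℕ) (k : Fin m → ℕ) (x : ∀ i : Fin m, Fin (k i) → M)
    (hgen : AddSubgroup.closure {z : M | ∃ i j, z = x i j} = ⊤)
    (hinj : ∀ i, Function.Injective (x i))
    (hstable : ∀ (i : Fin m) (a : A) (j : Fin (k i)), ∃ j', a • x i j = x i j')
    (htrans : ∀ (i : Fin m) (j j' : Fin (k i)), ∃ a : A, a • x i j = x i j')
    (y : M) (hy : ∀ a : A, a • y = y) :
    (Fintype.card A) • y ∈ AddSubgroup.closure {z : M | ∃ i : Fin m, z = ∑ j, x i j} := by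
  classical
  have hnorm : ∀ z : M, ∑ a : A, a • z ∈
      AddSubgroup.closure {z : M | ∃ i : Fin m, z = ∑ j, x i j} := by
    intro z
    have hz : z ∈ AddSubgroup.closure {z : M | ∃ i j, z = x i j} := hgen ▸ AddSubgroup.mem_top z
    induction hz using AddSubgroup.closure_induction with
    | mem z hz =>
      obtain ⟨i, j, rfl⟩ := hz
      rw [sum_smul_eq_card_smul_sum_orbit (hinj i) (hstable i) (htrans i)]
      refine nsmul_mem (AddSubgroup.subset_closure ?_) _
      exact ⟨i, rfl⟩
    | zero => simp
    | add z w _ _ hz hw =>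
      simpa only [smul_add, Finset.sum_add_distrib] using add_mem hz hw
    | neg z _ hz =>
      simpa only [smul_neg, Finset.sum_neg_distrib] using neg_mem hz
  simpa [hy] using hnorm y
end

section
/- Let 𝔰𝔩₂(ℂ) be the Lie algebra of traceless 2×2 complex matrices. The set {x ∧ ⁅z, x⁆ : x ∈ 𝔰𝔩₂(ℂ) nilpotent with x ≠ 0, z ∈ 𝔰𝔩₂(ℂ)} spans the full exterior square ⋀²(𝔰𝔩₂(ℂ)) (a 3-dimensional vector space). That is, the variety of tangential lines of the cone of nonzero nilpotent elements of 𝔰𝔩₂(ℂ) is linearly non-degenerate in ⋀²(𝔰𝔩₂(ℂ)). -/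
open LieAlgebra.SpecialLinear in
/-- The traceless matrix with rows `(a, b)` and `(c, -a)`. -/
def sl2Mk (a b c : ℂ) : sl (Fin 2) ℂ :=
  ⟨!![a, b; c, -a], by
    change _ ∈ LinearMap.ker (Matrix.traceLinearMap (Fin 2) ℂ ℂ)
    simp [Matrix.trace_fin_two]⟩

lemma coe_sl2Mk (a b c : ℂ) :
    (sl2Mk a b c : Matrix (Fin 2) (Fin 2) ℂ) = !![a, b; c, -a] := rfl

lemma exists_eq_sl2Mk (x : LieAlgebra.SpecialLinear.sl (Fin 2) ℂ) :
    ∃ a b c, x = sl2Mk a b c := by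
  obtain ⟨x, hx⟩ := x
  have hx' : x ∈ LinearMap.ker (Matrix.traceLinearMap (Fin 2) ℂ ℂ) := hx
  simp only [LinearMap.mem_ker, Matrix.traceLinearMap_apply, Matrix.trace_fin_two] at hx'
  refine ⟨x 0 0, x 0 1, x 1 0, Subtype.ext ?_⟩
  rw [coe_sl2Mk, ← eq_neg_of_add_eq_zero_right hx']
  exact Matrix.eta_fin_two x

lemma sl2Mk_eq_smul_add (a b c : ℂ) :
    sl2Mk a b c = a • sl2Mk 1 0 0 + b • sl2Mk 0 1 0 + c • sl2Mk 0 0 1 := by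
  apply Subtype.ext
  ext i j
  fin_cases i <;> fin_cases j <;> simp [coe_sl2Mk]

lemma lie_sl2Mk (a b c a' b' c' : ℂ) :
    ⁅sl2Mk a b c, sl2Mk a' b' c'⁆ =
      sl2Mk (b * c' - b' * c) (2 * (a * b' - a' * b)) (2 * (c * a' - c' * a)) := by
  apply Subtype.ext
  rw [LieAlgebra.SpecialLinear.sl_bracket]
  simp only [coe_sl2Mk]
  ext i j
  fin_cases i <;> fin_cases j <;> simp <;> ring

lemma sl2Mk_mul_self {a b c : ℂ} (h : a * a + b * c = 0) :
    (sl2Mk a b c : Matrix (Fin 2) (Fin 2) ℂ) * (sl2Mk a b c : Matrix (Fin 2) (Fin 2) ℂ) = 0 := by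
  simp only [coe_sl2Mk]
  ext i j
  fin_cases i <;> fin_cases j <;> simp <;>
    first | ring1 | linear_combination h

lemma sl2Mk_ne_zero {a b c : ℂ} (h : b ≠ 0 ∨ c ≠ 0) : sl2Mk a b c ≠ 0 := by
  intro h0
  have h1 := congrArg (Subtype.val) h0
  have hb := congrFun (congrFun h1 0) 1
  have hc := congrFun (congrFun h1 1) 0
  simp [coe_sl2Mk] at hb hc
  simp [hb, hc] at h

lemma exteriorPower_two_sl2_le
    {S : Submodule ℂ (ExteriorAlgebra ℂ (LieAlgebra.SpecialLinear.sl (Fin 2) ℂ))}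
    (hS : ∀ x z : LieAlgebra.SpecialLinear.sl (Fin 2) ℂ, x ≠ 0 →
      (x : Matrix (Fin 2) (Fin 2) ℂ) * (x : Matrix (Fin 2) (Fin 2) ℂ) = 0 →
      ExteriorAlgebra.ι ℂ x * ExteriorAlgebra.ι ℂ ⁅z, x⁆ ∈ S) :
    ⋀[ℂ]^2 (LieAlgebra.SpecialLinear.sl (Fin 2) ℂ) ≤ S := by
  change LinearMap.range (ExteriorAlgebra.ι ℂ) ^ 2 ≤ _
  rw [pow_two, Submodule.mul_le]
  rintro _ ⟨u, rfl⟩ _ ⟨v, rfl⟩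
  have key (a b c p q r : ℂ) (h : a * a + b * c = 0) (hbc : b ≠ 0 ∨ c ≠ 0) :
      ExteriorAlgebra.ι ℂ (sl2Mk a b c) *
        ExteriorAlgebra.ι ℂ ⁅sl2Mk p q r, sl2Mk a b c⁆ ∈ S :=
    hS _ _ (sl2Mk_ne_zero hbc) (sl2Mk_mul_self h)
  have ke := key 0 1 0 0 0 (-1) (by simp) (by simp)
  have kf := key 0 0 1 0 1 0 (by simp) (by simp)
  have kx := key 1 1 (-1) (1 / 2) 0 0 (by simp) (by simp)
  obtain ⟨a, b, c, rfl⟩ := exists_eq_sl2Mk u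
  obtain ⟨p, q, r, rfl⟩ := exists_eq_sl2Mk v
  rw [lie_sl2Mk] at ke kf kx
  rw [sl2Mk_eq_smul_add a, sl2Mk_eq_smul_add p]
  rw [sl2Mk_eq_smul_add 1 1] at kx
  norm_num at ke kf kx
  rw [sl2Mk_eq_smul_add 0 1 1] at kx
  simp only [map_add, map_smul, one_smul, zero_smul, zero_add] at kx ⊢
  have hH := ExteriorAlgebra.ι_sq_zero (R := ℂ) (sl2Mk 1 0 0)
  have hE := ExteriorAlgebra.ι_sq_zero (R := ℂ) (sl2Mk 0 1 0)
  have hF := ExteriorAlgebra.ι_sq_zero (R := ℂ) (sl2Mk 0 0 1)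
  have hHE := eq_neg_of_add_eq_zero_left
    (ExteriorAlgebra.ι_add_mul_swap (R := ℂ) (sl2Mk 1 0 0) (sl2Mk 0 1 0))
  have hHF := eq_neg_of_add_eq_zero_left
    (ExteriorAlgebra.ι_add_mul_swap (R := ℂ) (sl2Mk 1 0 0) (sl2Mk 0 0 1))
  have hFE := eq_neg_of_add_eq_zero_left
    (ExteriorAlgebra.ι_add_mul_swap (R := ℂ) (sl2Mk 0 0 1) (sl2Mk 0 1 0))
  generalize ExteriorAlgebra.ι ℂ (sl2Mk 1 0 0) = H at *
  generalize ExteriorAlgebra.ι ℂ (sl2Mk 0 1 0) = E at *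
  generalize ExteriorAlgebra.ι ℂ (sl2Mk 0 0 1) = F at *
  have hEF : E * F ∈ S := by
    convert S.smul_mem (1 / 2 : ℂ) (S.add_mem (S.add_mem kx ke) kf) using 1
    simp only [add_mul, mul_add, neg_mul, hE, hF, hHE, hHF, hFE]
    module
  convert S.add_mem (S.add_mem (S.smul_mem (b * p - a * q) ke) (S.smul_mem (c * p - a * r) kf))
    (S.smul_mem (b * r - c * q) hEF) using 1
  simp only [add_mul, mul_add, smul_mul_assoc, mul_smul_comm, hE, hF, hH, hHE, hHF, hFE]
  module

/-- The set `{x ∧ ⁅z, x⁆ : x ∈ 𝔰𝔩₂(ℂ) nilpotent, x ≠ 0, z ∈ 𝔰𝔩₂(ℂ)}`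
spans the full exterior square `⋀² 𝔰𝔩₂(ℂ)`: the variety of tangential lines of the cone of
nonzero nilpotent elements of `𝔰𝔩₂(ℂ)` is linearly non-degenerate in `⋀² 𝔰𝔩₂(ℂ)`. -/
theorem sl2_nilpotent_tangential_lines_span :
    Submodule.span ℂ
      {w : ExteriorAlgebra ℂ (LieAlgebra.SpecialLinear.sl (Fin 2) ℂ) |
        ∃ x z : LieAlgebra.SpecialLinear.sl (Fin 2) ℂ,
          x ≠ 0 ∧
          (x : Matrix (Fin 2) (Fin 2) ℂ) * (x : Matrix (Fin 2) (Fin 2) ℂ) = 0 ∧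
          w = ExteriorAlgebra.ι ℂ x * ExteriorAlgebra.ι ℂ ⁅z, x⁆} =
    ⋀[ℂ]^2 (LieAlgebra.SpecialLinear.sl (Fin 2) ℂ) := by
  apply le_antisymm
  · rw [Submodule.span_le]
    rintro _ ⟨x, z, -, -, rfl⟩
    change _ ∈ LinearMap.range (ExteriorAlgebra.ι ℂ) ^ 2
    rw [pow_two]
    exact Submodule.mul_mem_mul ⟨_, rfl⟩ ⟨_, rfl⟩
  · exact exteriorPower_two_sl2_le fun x z hx hxx =>
      Submodule.subset_span ⟨x, z, hx, hxx, rfl⟩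
end
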